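/- Let N ≥ 3, let X ⊆ ℝ^N be a domain, let p > N/2, and let V : ℝ^N → ℝ be nonnegative and locally L^p-integrable on X, with μ_X > 0. Let Ω ⊆ X be a domain admitting some smooth compactly supported function u₀ with support in Ω and ∫ V u₀² > 0, and let B be an open set with compact closure contained in X such that μ_{Ω∪B} < μ_Ω. Then every normalized minimizing sequence for μ_{Ω∪B} has a subsequence (u_{k_j}) whose gradients (∇u_{k_j}) form a Cauchy sequence in L²(ℝ^N; ℝ^N); in particular the infimum μ_{Ω∪B} is attained in the completion D^{1,2}(Ω∪B). -/

import Mathlib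

open MeasureTheory Filter Topology

/-- The Dirichlet energy `∫ |∇u|²` of a function on `ℝᴺ`. -/
noncomputable def grad2 (N : ℕ) (u : EuclideanSpace ℝ (Fin N) → ℝ) : ℝ :=
  ∫ x, ‖fderiv ℝ u x‖ ^ 2

/-- The weighted mass `∫ V u²`. -/
noncomputable def ven (N : ℕ) (V u : EuclideanSpace ℝ (Fin N) → ℝ) : ℝ :=
  ∫ x, V x * u x ^ 2

/-- A smooth test function with compact support contained in `Ω`. -/
def IsTest (N : ℕ) (Ω : Set (EuclideanSpace ℝ (Fin N)))
    (u : EuclideanSpace ℝ (Fin N) → ℝ) : Prop :=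
  ContDiff ℝ (⊤ : ℕ∞) u ∧ HasCompactSupport u ∧ tsupport u ⊆ Ω

/-- The Rayleigh quotient infimum `μ_Ω`. -/
noncomputable def mu (N : ℕ) (V : EuclideanSpace ℝ (Fin N) → ℝ)
    (Ω : Set (EuclideanSpace ℝ (Fin N))) : ℝ :=
  sInf {q : ℝ | ∃ u, IsTest N Ω u ∧ 0 < ven N V u ∧ q = grad2 N u / ven N V u}

/-- A normalized minimizing sequence for `μ_Ω`. -/
def MinimizingSeq (N : ℕ) (V : EuclideanSpace ℝ (Fin N) → ℝ)
    (Ω : Set (EuclideanSpace ℝ (Fin N)))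
    (u : ℕ → EuclideanSpace ℝ (Fin N) → ℝ) : Prop :=
  (∀ k, IsTest N Ω (u k)) ∧ (∀ k, ven N V (u k) = 1) ∧
    Tendsto (fun k => grad2 N (u k)) atTop (𝓝 (mu N V Ω))

/-- The gradients `∇u_k` form a Cauchy sequence in `L²(ℝᴺ; ℝᴺ)`. -/
def GradCauchy (N : ℕ) (u : ℕ → EuclideanSpace ℝ (Fin N) → ℝ) : Prop :=
  ∀ ε : ℝ, 0 < ε → ∃ M : ℕ, ∀ j ≥ M, ∀ l ≥ M,
    (∫ x, ‖fderiv ℝ (u j) x - fderiv ℝ (u l) x‖ ^ 2) < ε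

/-- `V` is locally `L^p` on `X`. -/
def LocLp (N : ℕ) (p : ℝ) (V : EuclideanSpace ℝ (Fin N) → ℝ)
    (X : Set (EuclideanSpace ℝ (Fin N))) : Prop :=
  ∀ K : Set (EuclideanSpace ℝ (Fin N)), IsCompact K → K ⊆ X →
    IntegrableOn (fun x => V x ^ p) K

theorem sq_integral_le_integral_sq {α : Type*} [MeasurableSpace α] {ν : Measure α}
    [IsProbabilityMeasure ν] {f : α → ℝ} (hf : Integrable f ν)
    (hf2 : Integrable (fun x => f x ^ 2) ν) : (∫ x, f x ∂ν) ^ 2 ≤ ∫ x, f x ^ 2 ∂ν := by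
  have h : 0 ≤ ∫ x, (f x - ∫ y, f y ∂ν) ^ 2 ∂ν := integral_nonneg fun x => sq_nonneg _
  set m := ∫ y, f y ∂ν with hm
  have h1 : ∫ x, (f x - m) ^ 2 ∂ν = (∫ x, f x ^ 2 ∂ν) - 2 * m * m + m ^ 2 := by
    have : (fun x => (f x - m) ^ 2) = fun x => (f x ^ 2 - 2 * m * f x) + m ^ 2 := by
      ext x; ring
    have hmf : Integrable (fun x => 2 * m * f x) ν := hf.const_mul _
    have hsub : Integrable (fun x => f x ^ 2 - 2 * m * f x) ν := hf2.sub hmf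
    rw [this, integral_add hsub (integrable_const _), integral_sub hf2 hmf,
      integral_const_mul, ← hm]
    simp
  nlinarith

theorem integrable_sq {E : Type*} [TopologicalSpace E] [MeasurableSpace E] [BorelSpace E]
    {μ : Measure E} [IsFiniteMeasureOnCompacts μ] {u : E → ℝ} (hu : Continuous u)
    (hc : HasCompactSupport u) : Integrable (fun x => u x ^ 2) μ := by
  simp only [sq]
  exact (hu.mul hu).integrable_of_hasCompactSupport hc.mul_right

theorem integrable_sq_translate_sub {E : Type*} [NormedAddCommGroup E] [MeasurableSpace E]
    [BorelSpace E] {μ : Measure E} [IsFiniteMeasureOnCompacts μ] {u : E → ℝ} (hu : Continuous u)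
    (hc : HasCompactSupport u) (z : E) : Integrable (fun x => (u (x + z) - u x) ^ 2) μ :=
  integrable_sq (u := fun x => u (x + z) - u x) (by fun_prop)
    ((hc.comp_homeomorph (Homeomorph.addRight z)).sub hc)

section Haar

variable {E : Type*} [NormedAddCommGroup E] [NormedSpace ℝ E]

theorem sq_sub_le_norm_sq_mul_integral {u : E → ℝ} (hu : ContDiff ℝ 1 u) (x z : E) :
    (u (x + z) - u x) ^ 2 ≤
      ‖z‖ ^ 2 * ∫ t in Set.Ioc (0 : ℝ) 1, ‖fderiv ℝ u (x + t • z)‖ ^ 2 := by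
  have hcont : Continuous fun t : ℝ => fderiv ℝ u (x + t • z) :=
    (hu.continuous_fderiv one_ne_zero).comp (by fun_prop)
  have hftc : ∫ t in (0 : ℝ)..1, fderiv ℝ u (x + t • z) z = u (x + z) - u x := by
    have := intervalIntegral.integral_eq_sub_of_hasDerivAt
      (f := fun t : ℝ => u (x + t • z)) (f' := fun t : ℝ => fderiv ℝ u (x + t • z) z)
      (a := 0) (b := 1) (fun t _ => by
        have h1 : HasDerivAt (fun t : ℝ => x + t • z) z t := by
          simpa using ((hasDerivAt_id t).smul_const z).const_add x
        exact ((hu.differentiable one_ne_zero) _).hasFDerivAt.comp_hasDerivAt t h1)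
      ((by fun_prop : Continuous _).intervalIntegrable _ _)
    simpa using this
  have : IsProbabilityMeasure (volume.restrict (Set.Ioc (0 : ℝ) 1)) := ⟨by simp⟩
  have hI : ∀ g : ℝ → ℝ, Continuous g → Integrable g (volume.restrict (Set.Ioc (0 : ℝ) 1)) :=
    fun g hg => (hg.integrableOn_Icc (a := 0) (b := 1)).mono_set Set.Ioc_subset_Icc_self
  rw [← hftc, intervalIntegral.integral_of_le zero_le_one]
  refine (sq_integral_le_integral_sq (hI _ (by fun_prop)) (hI _ (by fun_prop))).trans ?_
  rw [← integral_const_mul]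
  refine integral_mono (hI _ (by fun_prop)) (hI _ (by fun_prop)) fun t => ?_
  have := (fderiv ℝ u (x + t • z)).le_opNorm z
  rw [← mul_pow, ← sq_abs (fderiv ℝ u (x + t • z) z), mul_comm ‖z‖]
  exact pow_le_pow_left₀ (abs_nonneg _) this 2

variable [MeasurableSpace E] [BorelSpace E] {μ : Measure E} [μ.IsAddHaarMeasure]

theorem integrable_norm_fderiv_sq {u : E → ℝ} (hu : ContDiff ℝ 1 u) (hc : HasCompactSupport u) :
    Integrable (fun x => ‖fderiv ℝ u x‖ ^ 2) μ :=
  integrable_sq (hu.continuous_fderiv one_ne_zero).norm (hc.fderiv ℝ).norm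

variable [FiniteDimensional ℝ E]

/-- Translation estimate: moving `u` by `z` costs at most `‖z‖` times the gradient in `L²`. -/
theorem integral_sq_translate_sub_le {u : E → ℝ} (hu : ContDiff ℝ 1 u)
    (hc : HasCompactSupport u) (z : E) :
    ∫ x, (u (x + z) - u x) ^ 2 ∂μ ≤ ‖z‖ ^ 2 * ∫ x, ‖fderiv ℝ u x‖ ^ 2 ∂μ := by
  set ν := volume.restrict (Set.Ioc (0 : ℝ) 1)
  have hg := integrable_norm_fderiv_sq (μ := μ) hu hc
  have hcont := hu.continuous_fderiv one_ne_zero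
  have hint : Integrable (fun q : E × ℝ => ‖fderiv ℝ u (q.1 + q.2 • z)‖ ^ 2) (μ.prod ν) := by
    have hm : Continuous (fun q : E × ℝ => ‖fderiv ℝ u (q.1 + q.2 • z)‖ ^ 2) := by fun_prop
    rw [integrable_prod_iff' hm.aestronglyMeasurable]
    refine ⟨ae_of_all _ fun t => hg.comp_add_right (t • z), ?_⟩
    simp only [norm_pow, norm_norm]
    simp_rw [fun t : ℝ => integral_add_right_eq_self (μ := μ) (fun x => ‖fderiv ℝ u x‖ ^ 2) (t • z)]
    exact integrable_const _
  calc ∫ x, (u (x + z) - u x) ^ 2 ∂μ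
      ≤ ∫ x, ‖z‖ ^ 2 * ∫ t, ‖fderiv ℝ u (x + t • z)‖ ^ 2 ∂ν ∂μ :=
        integral_mono (integrable_sq_translate_sub hu.continuous hc z)
          (hint.integral_prod_left.const_mul _) fun x => sq_sub_le_norm_sq_mul_integral hu x z
    _ = ‖z‖ ^ 2 * ∫ x, ‖fderiv ℝ u x‖ ^ 2 ∂μ := by
        rw [integral_const_mul, integral_integral_swap hint]
        simp_rw [fun t : ℝ =>
          integral_add_right_eq_self (μ := μ) (fun x => ‖fderiv ℝ u x‖ ^ 2) (t • z)]
        simp [ν]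

/-- Local `L²` mass is controlled by averages over small displacements and the Dirichlet
energy. -/
theorem setIntegral_sq_le_average {u : E → ℝ} (hu : ContDiff ℝ 1 u) (hc : HasCompactSupport u)
    {ν : Measure E} [IsProbabilityMeasure ν] {ε : ℝ} (hν : ∀ᵐ z ∂ν, ‖z‖ ≤ ε)
    {K : Set E} (hK : μ K ≠ ⊤) :
    ∫ x in K, u x ^ 2 ∂μ ≤ 2 * (∫ x in K, (∫ z, u (x + z) ∂ν) ^ 2 ∂μ) +
      2 * (ε ^ 2 * ∫ x, ‖fderiv ℝ u x‖ ^ 2 ∂μ) := by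
  have huc := hu.continuous
  obtain ⟨C, hC⟩ := hc.exists_bound_of_continuous huc
  have hC0 : 0 ≤ C := (norm_nonneg _).trans (hC 0)
  have hbd : ∀ g : E → ℝ, Continuous g → (∃ D, ∀ z, ‖g z‖ ≤ D) → Integrable g ν := by
    rintro g hg ⟨D, hD⟩
    exact (integrable_const D).mono' hg.aestronglyMeasurable (ae_of_all _ hD)
  have hI1 : ∀ x, Integrable (fun z => u (x + z)) ν :=
    fun x => hbd _ (by fun_prop) ⟨C, fun z => hC _⟩
  have hI2 : ∀ x, Integrable (fun z => u (x + z) - u x) ν :=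
    fun x => (hI1 x).sub (integrable_const _)
  have hI3 : ∀ x, Integrable (fun z => (u (x + z) - u x) ^ 2) ν := fun x =>
    hbd _ (by fun_prop) ⟨(C + C) ^ 2, fun z => by
      rw [norm_pow]
      exact pow_le_pow_left₀ (norm_nonneg _) ((norm_sub_le _ _).trans (add_le_add (hC _) (hC _))) 2⟩
  have hF : Continuous (fun q : E × E => (u (q.1 + q.2) - u q.1) ^ 2) := by fun_prop
  have hle : ∀ᵐ z ∂ν, ∫ x, (u (x + z) - u x) ^ 2 ∂μ ≤ ε ^ 2 * ∫ x, ‖fderiv ℝ u x‖ ^ 2 ∂μ := by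
    filter_upwards [hν] with z hz
    refine (integral_sq_translate_sub_le hu hc z).trans ?_
    gcongr
  have hint : Integrable (fun q : E × E => (u (q.1 + q.2) - u q.1) ^ 2) (μ.prod ν) := by
    rw [integrable_prod_iff' hF.aestronglyMeasurable]
    refine ⟨ae_of_all _ fun z => integrable_sq_translate_sub huc hc z, ?_⟩
    refine (integrable_const (ε ^ 2 * ∫ x, ‖fderiv ℝ u x‖ ^ 2 ∂μ)).mono'
      hF.norm.stronglyMeasurable.integral_prod_left'.aestronglyMeasurable ?_
    filter_upwards [hle] with z hz
    rw [Real.norm_of_nonneg (integral_nonneg fun x => norm_nonneg _)]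
    simpa using hz
  have hA : Integrable (fun x => (∫ z, u (x + z) ∂ν) ^ 2) (μ.restrict K) := by
    have : IsFiniteMeasure (μ.restrict K) := ⟨by simpa using hK.lt_top⟩
    refine (integrable_const (C ^ 2)).mono' ?_ (ae_of_all _ fun x => ?_)
    · exact (((huc.comp continuous_add).stronglyMeasurable.integral_prod_right'
        (ν := ν)).pow 2).aestronglyMeasurable
    · rw [norm_pow]
      refine pow_le_pow_left₀ (norm_nonneg _) ?_ 2
      simpa using norm_integral_le_of_norm_le_const (μ := ν) (ae_of_all _ fun z => hC (x + z))
  have hpt : ∀ x, u x ^ 2 ≤ 2 * (∫ z, u (x + z) ∂ν) ^ 2 +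
      2 * ∫ z, (u (x + z) - u x) ^ 2 ∂ν := by
    intro x
    have h1 := sq_integral_le_integral_sq (hI2 x) (hI3 x)
    rw [integral_sub (hI1 x) (integrable_const _)] at h1
    simp only [integral_const, probReal_univ, one_smul] at h1
    nlinarith [sq_nonneg (2 * (∫ z, u (x + z) ∂ν) - u x)]
  calc ∫ x in K, u x ^ 2 ∂μ
      ≤ ∫ x in K, (2 * (∫ z, u (x + z) ∂ν) ^ 2 + 2 * ∫ z, (u (x + z) - u x) ^ 2 ∂ν) ∂μ :=
        integral_mono (integrable_sq huc hc).integrableOn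
          ((hA.const_mul 2).add (hint.integral_prod_left.const_mul 2).integrableOn) hpt
    _ = 2 * (∫ x in K, (∫ z, u (x + z) ∂ν) ^ 2 ∂μ) +
        2 * ∫ x in K, ∫ z, (u (x + z) - u x) ^ 2 ∂ν ∂μ := by
        rw [integral_add (hA.const_mul 2) (hint.integral_prod_left.const_mul 2).integrableOn,
          integral_const_mul, integral_const_mul]
    _ ≤ _ := by
        gcongr
        calc ∫ x in K, ∫ z, (u (x + z) - u x) ^ 2 ∂ν ∂μ
            ≤ ∫ x, ∫ z, (u (x + z) - u x) ^ 2 ∂ν ∂μ :=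
              setIntegral_le_integral hint.integral_prod_left
                (ae_of_all _ fun x => integral_nonneg fun z => sq_nonneg _)
          _ = ∫ z, ∫ x, (u (x + z) - u x) ^ 2 ∂μ ∂ν := integral_integral_swap hint
          _ ≤ ∫ z, ε ^ 2 * ∫ x, ‖fderiv ℝ u x‖ ^ 2 ∂μ ∂ν :=
              integral_mono_ae hint.integral_prod_right (integrable_const _) hle
          _ = _ := by simp

end Haar

/-- Weak sequential compactness of bounded sets in `L²`, tested against indicators. -/
theorem exists_subseq_tendsto_setIntegral {α : Type*} [MeasurableSpace α]
    [MeasurableSpace.CountablyGenerated α] {ν : Measure α} [IsFiniteMeasure ν]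
    {u : ℕ → α → ℝ} (hu : ∀ n, MemLp (u n) 2 ν) {M : ℝ} (hM : ∀ n, ∫ x, u n x ^ 2 ∂ν ≤ M) :
    ∃ k : ℕ → ℕ, StrictMono k ∧ ∀ s, MeasurableSet s →
      ∃ l, Tendsto (fun j => ∫ x in s, u (k j) x ∂ν) atTop (𝓝 l) := by
  have : Fact ((2 : ENNReal) ≠ ⊤) := ⟨by simp⟩
  have : SecondCountableTopology (Lp ℝ 2 ν) := inferInstance
  let f : ℕ → Lp ℝ 2 ν := fun n => (hu n).toLp (u n)
  have hf : ∀ n, ‖f n‖ ≤ √M := fun n => by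
    refine Real.le_sqrt_of_sq_le (le_trans (le_of_eq ?_) (hM n))
    rw [← real_inner_self_eq_norm_sq, L2.inner_def]
    refine integral_congr_ae ?_
    filter_upwards [(hu n).coeFn_toLp] with x hx
    simp [f, hx, sq]
  have hmem : ∀ n, StrongDual.toWeakDual (innerSL ℝ (f n)) ∈
      (WeakDual.toStrongDual ⁻¹' Metric.closedBall (0 : StrongDual ℝ (Lp ℝ 2 ν)) (√M)) := by
    intro n
    simpa using hf n
  obtain ⟨φ, -, k, hk, hlim⟩ := WeakDual.isSeqCompact_closedBall ℝ (Lp ℝ 2 ν) 0 (√M) hmem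
  refine ⟨k, hk, fun s hs => ⟨φ (indicatorConstLp 2 hs (measure_ne_top ν s) 1), ?_⟩⟩
  have h1 := ((WeakDual.eval_continuous (𝕜 := ℝ)
    (indicatorConstLp 2 hs (measure_ne_top ν s) (1 : ℝ))).tendsto φ).comp hlim
  refine h1.congr fun j => ?_
  have h2 : (StrongDual.toWeakDual (innerSL ℝ (f (k j))))
      (indicatorConstLp 2 hs (measure_ne_top ν s) (1 : ℝ)) =
      inner ℝ (f (k j)) (indicatorConstLp 2 hs (measure_ne_top ν s) (1 : ℝ)) := rfl
  change (StrongDual.toWeakDual (innerSL ℝ (f (k j))))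
      (indicatorConstLp 2 hs (measure_ne_top ν s) (1 : ℝ)) = _
  rw [h2, real_inner_comm, L2.inner_indicatorConstLp_one]
  exact integral_congr_ae (ae_restrict_of_ae (hu (k j)).coeFn_toLp)

/-- The squared `L²` distance is at most twice the sum of the squared norms. -/
theorem integral_norm_sub_sq_le {α F : Type*} [MeasurableSpace α] {μ : Measure α}
    [NormedAddCommGroup F] {f g : α → F} (hf : Integrable (fun x => ‖f x‖ ^ 2) μ)
    (hg : Integrable (fun x => ‖g x‖ ^ 2) μ) :
    ∫ x, ‖f x - g x‖ ^ 2 ∂μ ≤ 2 * (∫ x, ‖f x‖ ^ 2 ∂μ) + 2 * ∫ x, ‖g x‖ ^ 2 ∂μ := by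
  rw [← integral_const_mul, ← integral_const_mul,
    ← integral_add (hf.const_mul 2) (hg.const_mul 2)]
  refine integral_mono_of_nonneg (ae_of_all _ fun x => by positivity)
    ((hf.const_mul 2).add (hg.const_mul 2)) (ae_of_all _ fun x => ?_)
  have h1 := norm_sub_le (f x) (g x)
  have h2 := pow_le_pow_left₀ (norm_nonneg _) h1 2
  simp only
  nlinarith [sq_nonneg (‖f x‖ - ‖g x‖)]

theorem fderiv_fun_sub_apply {E : Type*} [NormedAddCommGroup E] [NormedSpace ℝ E] {u v : E → ℝ}
    (hu : ContDiff ℝ 1 u) (hv : ContDiff ℝ 1 v) (x : E) :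
    fderiv ℝ (fun y => u y - v y) x = fderiv ℝ u x - fderiv ℝ v x :=
  fderiv_fun_sub (hu.differentiable one_ne_zero x) (hv.differentiable one_ne_zero x)

/-- Local Rellich compactness. -/
theorem exists_subseq_tendsto_setIntegral_sq_sub
    {E : Type*} [NormedAddCommGroup E] [NormedSpace ℝ E] [FiniteDimensional ℝ E]
    [MeasurableSpace E] [BorelSpace E] {μ : Measure E} [μ.IsAddHaarMeasure]
    {u : ℕ → E → ℝ} (hu : ∀ n, ContDiff ℝ 1 (u n)) (hc : ∀ n, HasCompactSupport (u n))
    {G : ℝ} (hG : ∀ n, ∫ x, ‖fderiv ℝ (u n) x‖ ^ 2 ∂μ ≤ G) {R M : ℝ}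
    (hM : ∀ n, ∫ x in Metric.closedBall 0 (R + 1), u n x ^ 2 ∂μ ≤ M) :
    ∃ k : ℕ → ℕ, StrictMono k ∧
      Tendsto (fun q : ℕ × ℕ => ∫ x in Metric.closedBall 0 R, (u (k q.1) x - u (k q.2) x) ^ 2 ∂μ)
        atTop (𝓝 0) := by
  set D : Set E := Metric.closedBall 0 (R + 1) with hD
  set K : Set E := Metric.closedBall 0 R with hK
  have hDfin : μ D < ⊤ := measure_closedBall_lt_top
  have hKfin : μ K < ⊤ := measure_closedBall_lt_top
  have : IsFiniteMeasure (μ.restrict D) := ⟨by simpa using hDfin⟩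
  have : IsFiniteMeasure (μ.restrict K) := ⟨by simpa using hKfin⟩
  have hsqD : ∀ n, Integrable (fun x => u n x ^ 2) (μ.restrict D) :=
    fun n => (integrable_sq (hu n).continuous (hc n)).integrableOn
  obtain ⟨k, hk, hlim⟩ := exists_subseq_tendsto_setIntegral (ν := μ.restrict D) (u := u)
    (fun n => ((hu n).continuous.memLp_of_hasCompactSupport (hc n)).restrict D) hM
  refine ⟨k, hk, ?_⟩
  let w : ℕ × ℕ → E → ℝ := fun q x => u (k q.1) x - u (k q.2) x
  have hw : ∀ q, ContDiff ℝ 1 (w q) := fun q => (hu _).sub (hu _)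
  have hwc : ∀ q, HasCompactSupport (w q) := fun q => (hc _).sub (hc _)
  have hG0 : 0 ≤ G := (integral_nonneg fun x => by positivity).trans (hG 0)
  have hwG : ∀ q, ∫ x, ‖fderiv ℝ (w q) x‖ ^ 2 ∂μ ≤ 4 * G := by
    intro q
    simp only [w, fderiv_fun_sub_apply (hu _) (hu _)]
    refine (integral_norm_sub_sq_le (integrable_norm_fderiv_sq (hu _) (hc _))
      (integrable_norm_fderiv_sq (hu _) (hc _))).trans ?_
    linarith [hG (k q.1), hG (k q.2)]
  have hwM : ∀ q, ∫ x in D, w q x ^ 2 ∂μ ≤ 4 * M := by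
    intro q
    have := integral_norm_sub_sq_le (μ := μ.restrict D) (f := u (k q.1)) (g := u (k q.2))
      (by simpa using hsqD _) (by simpa using hsqD _)
    simp only [Real.norm_eq_abs, sq_abs] at this
    exact this.trans (by linarith [hM (k q.1), hM (k q.2)])
  rw [Metric.tendsto_nhds]
  intro δ hδ
  obtain ⟨ε, hε0, hε1, hε⟩ : ∃ ε : ℝ, 0 < ε ∧ ε ≤ 1 ∧ 2 * (ε ^ 2 * (4 * G)) < δ / 2 := by
    have hT : Tendsto (fun ε : ℝ => 2 * (ε ^ 2 * (4 * G))) (𝓝[>] 0) (𝓝 0) := by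
      have : Continuous fun ε : ℝ => 2 * (ε ^ 2 * (4 * G)) := by fun_prop
      simpa using (this.tendsto 0).mono_left nhdsWithin_le_nhds
    obtain ⟨ε, h1, h2, h3⟩ := ((hT.eventually (gt_mem_nhds (half_pos hδ))).and
      ((eventually_mem_nhdsWithin).and
        (nhdsWithin_le_nhds (gt_mem_nhds (zero_lt_one' ℝ))))).exists
    exact ⟨ε, h2, le_of_lt h3, h1⟩
  set S : Set E := Metric.closedBall 0 ε
  have hS0 : μ S ≠ 0 := (Metric.measure_closedBall_pos μ 0 hε0).ne'
  have hSt : μ S ≠ ⊤ := measure_closedBall_lt_top.ne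
  set ν : Measure E := ProbabilityTheory.cond μ S with hν
  have : IsProbabilityMeasure ν := ProbabilityTheory.cond_isProbabilityMeasure_of_finite hS0 hSt
  have hνS : ∀ᵐ z ∂ν, ‖z‖ ≤ ε := by
    have h1 : ∀ᵐ z ∂(μ.restrict S), ‖z‖ ≤ ε := by
      filter_upwards [ae_restrict_mem Metric.isClosed_closedBall.measurableSet] with z hz
      simpa [S] using hz
    exact Measure.ae_smul_measure h1 _
  have hav : ∀ f : E → ℝ, ∀ x, ∫ z, f (x + z) ∂ν =
      (μ S).toReal⁻¹ * ∫ y in Metric.closedBall x ε, f y ∂μ := by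
    intro f x
    rw [hν, ProbabilityTheory.cond, integral_smul_measure, ENNReal.toReal_inv, smul_eq_mul]
    congr 1
    have h1 := (measurePreserving_add_left μ x).setIntegral_preimage_emb
      (MeasurableEquiv.addLeft x).measurableEmbedding f (Metric.closedBall x ε)
    simpa [S] using h1
  have hsub : ∀ x ∈ K, Metric.closedBall x ε ⊆ D := fun x hx =>
    Metric.closedBall_subset_closedBall' (by
      have : dist x 0 ≤ R := hx
      linarith)
  have hA : Tendsto (fun q => ∫ x in K, (∫ z, w q (x + z) ∂ν) ^ 2 ∂μ) atTop (𝓝 0) := by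
    have h0 : ∫ x in K, (0 : ℝ) ∂μ = 0 := by simp
    rw [← h0]
    refine tendsto_integral_filter_of_dominated_convergence
      (fun _ => (μ S).toReal⁻¹ ^ 2 * ((μ D).toReal + 4 * M) ^ 2) ?_ ?_ (integrable_const _) ?_
    · refine Eventually.of_forall fun q => ?_
      exact ((((hw q).continuous.comp continuous_add).stronglyMeasurable.integral_prod_right'
        (ν := ν)).pow 2).aestronglyMeasurable
    · refine Eventually.of_forall fun q => ?_
      filter_upwards [ae_restrict_mem Metric.isClosed_closedBall.measurableSet] with x hx
      rw [norm_pow, hav, norm_mul, mul_pow, Real.norm_of_nonneg (by positivity)]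
      have hb : ‖∫ y in Metric.closedBall x ε, w q y ∂μ‖ ≤ (μ D).toReal + 4 * M := by
        have hi : Integrable (fun y => 1 + w q y ^ 2) (μ.restrict D) :=
          (integrable_const _).add (integrable_sq (hw q).continuous (hwc q)).integrableOn
        calc ‖∫ y in Metric.closedBall x ε, w q y ∂μ‖
            ≤ ∫ y in Metric.closedBall x ε, (1 + w q y ^ 2) ∂μ :=
              norm_integral_le_of_norm_le (hi.mono_measure (Measure.restrict_mono_set _ (hsub x hx)))
                (ae_of_all _ fun y => by
                  rw [Real.norm_eq_abs, ← sq_abs]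
                  nlinarith [sq_nonneg (|w q y| - 1), abs_nonneg (w q y)])
          _ ≤ ∫ y in D, (1 + w q y ^ 2) ∂μ :=
              setIntegral_mono_set hi (ae_of_all _ fun y => by positivity)
                (hsub x hx).eventuallyLE
          _ = (μ D).toReal + ∫ y in D, w q y ^ 2 ∂μ := by
              rw [integral_add (integrable_const _)
                (integrable_sq (hw q).continuous (hwc q)).integrableOn]
              simp [Measure.real]
          _ ≤ _ := by linarith [hwM q]
      gcongr
    · filter_upwards [ae_restrict_mem Metric.isClosed_closedBall.measurableSet] with x hx
      obtain ⟨l, hl⟩ := hlim (Metric.closedBall x ε) Metric.isClosed_closedBall.measurableSet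
      rw [Measure.restrict_restrict Metric.isClosed_closedBall.measurableSet,
        Set.inter_eq_left.2 (hsub x hx)] at hl
      have hq : Tendsto (fun q : ℕ × ℕ => ∫ y in Metric.closedBall x ε, w q y ∂μ) atTop
          (𝓝 (l - l)) := by
        have h1 := hl.comp (tendsto_fst (f := (atTop : Filter ℕ)) (g := (atTop : Filter ℕ)))
        have h2 := hl.comp (tendsto_snd (f := (atTop : Filter ℕ)) (g := (atTop : Filter ℕ)))
        rw [prod_atTop_atTop_eq] at h1 h2
        refine (h1.sub h2).congr fun q => ?_
        have hi : ∀ n, IntegrableOn (u n) (Metric.closedBall x ε) μ := fun n =>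
          ((hu n).continuous.integrable_of_hasCompactSupport (hc n)).integrableOn
        exact (integral_sub (hi _) (hi _)).symm
      simp_rw [hav]
      simpa using (hq.const_mul (μ S).toReal⁻¹).pow 2
  filter_upwards [hA.eventually (gt_mem_nhds (show (0 : ℝ) < δ / 4 by positivity))] with q hq
  rw [Real.dist_eq, sub_zero, abs_of_nonneg (integral_nonneg fun x => sq_nonneg _)]
  have h1 := setIntegral_sq_le_average (hw q) (hwc q) hνS (K := K) hKfin.ne
  have h2 : ε ^ 2 * ∫ x, ‖fderiv ℝ (w q) x‖ ^ 2 ∂μ ≤ ε ^ 2 * (4 * G) := by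
    gcongr
    exact hwG q
  change ∫ x in K, w q x ^ 2 ∂μ < δ
  linarith

/-- A uniform Young-type inequality with a small constant in the superlinear terms. -/
theorem exists_mul_le_add_rpow {r p η : ℝ} (hr : 1 < r) (hp : 1 < (p - 1) * (r - 1))
    (hη : 0 < η) :
    ∃ M : ℝ, 0 ≤ M ∧ ∀ v t : ℝ, 0 ≤ v → 0 ≤ t → v * t ≤ M * t + η * (t ^ r + v ^ p) := by
  set s := (p - 1) * (r - 1) - 1 with hs
  have hs0 : 0 < s := by linarith
  have hM0 : 0 < (η ^ (-r)) ^ s⁻¹ := by positivity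
  refine ⟨(η ^ (-r)) ^ s⁻¹, hM0.le, fun v t hv ht => ?_⟩
  have htr : 0 ≤ t ^ r := by positivity
  have hvp : 0 ≤ v ^ p := by positivity
  rcases le_or_gt v ((η ^ (-r)) ^ s⁻¹) with h | h
  · have := mul_le_mul_of_nonneg_right h ht
    have : 0 ≤ η * (t ^ r + v ^ p) := by positivity
    linarith
  have hv0 : 0 < v := hM0.trans h
  have hMt : 0 ≤ (η ^ (-r)) ^ s⁻¹ * t := by positivity
  rcases le_or_gt t (η * v ^ (p - 1)) with h' | h'
  · have h1 : v * t ≤ η * v ^ p := by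
      calc v * t ≤ v * (η * v ^ (p - 1)) := by gcongr
        _ = η * v ^ p := by rw [Real.rpow_sub_one hv0.ne']; field_simp
    nlinarith
  · have ht0 : 0 < t := lt_of_le_of_lt (by positivity) h'
    have h2 : η ^ (-r) ≤ v ^ s := by
      calc η ^ (-r) = ((η ^ (-r)) ^ s⁻¹) ^ s := by
            rw [← Real.rpow_mul (by positivity), inv_mul_cancel₀ hs0.ne', Real.rpow_one]
        _ ≤ v ^ s := Real.rpow_le_rpow hM0.le h.le hs0.le
    have h3 : v ≤ η * t ^ (r - 1) := by
      calc v = η ^ r * η ^ (-r) * v := by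
            rw [← Real.rpow_add hη]; simp
        _ ≤ η ^ r * v ^ s * v := by gcongr
        _ = η * (η * v ^ (p - 1)) ^ (r - 1) := by
            rw [Real.mul_rpow hη.le (by positivity), ← Real.rpow_mul hv,
              show (p - 1) * (r - 1) = s + 1 by rw [hs]; ring, Real.rpow_add_one hv0.ne',
              Real.rpow_sub_one hη.ne']
            field_simp
        _ ≤ η * t ^ (r - 1) := by
            have : (η * v ^ (p - 1)) ^ (r - 1) ≤ t ^ (r - 1) :=
              Real.rpow_le_rpow (by positivity) h'.le (by linarith)
            gcongr
    have h1 : v * t ≤ η * t ^ r := by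
      calc v * t ≤ η * t ^ (r - 1) * t := by gcongr
        _ = η * t ^ r := by rw [Real.rpow_sub_one ht0.ne']; field_simp
    nlinarith

theorem integrable_sq_rpow {E : Type*} [TopologicalSpace E] [MeasurableSpace E] [BorelSpace E]
    {μ : Measure E} [IsFiniteMeasureOnCompacts μ] {u : E → ℝ} (hu : Continuous u)
    (hc : HasCompactSupport u) {r : ℝ} (hr : 0 < r) :
    Integrable (fun x => (u x ^ 2) ^ r) μ := by
  refine ((hu.pow 2).rpow_const fun x => Or.inr hr.le).integrable_of_hasCompactSupport ?_
  refine hc.mono fun x hx => ?_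
  contrapose! hx
  simp only [Function.mem_support, not_not] at hx ⊢
  simp [hx, hr.ne']

theorem aestronglyMeasurable_of_rpow {α : Type*} [MeasurableSpace α] {ν : Measure α}
    {V : α → ℝ} (hV : ∀ x, 0 ≤ V x) {p : ℝ} (hp : p ≠ 0)
    (h : AEStronglyMeasurable (fun x => V x ^ p) ν) : AEStronglyMeasurable V ν := by
  have h1 := (h.aemeasurable.pow_const p⁻¹).aestronglyMeasurable
  refine h1.congr (ae_of_all _ fun x => ?_)
  simp only
  rw [← Real.rpow_mul (hV x), mul_inv_cancel₀ hp, Real.rpow_one]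

/-- Multiplication by a potential in `L^p` with `p` supercritical. -/
theorem integrable_mul_sq_of_rpow {E : Type*} [TopologicalSpace E] [MeasurableSpace E]
    [BorelSpace E] {μ ν : Measure E} [IsFiniteMeasureOnCompacts μ] (hν : ν ≤ μ)
    {V : E → ℝ} (hV : ∀ x, 0 ≤ V x)
    {r p : ℝ} (hr : 1 < r) (hp : 1 < (p - 1) * (r - 1))
    (hVp : Integrable (fun x => V x ^ p) ν) {u : E → ℝ}
    (hu : Continuous u) (hc : HasCompactSupport u) : Integrable (fun x => V x * u x ^ 2) ν := by
  have hp0 : p ≠ 0 := by rintro rfl; linarith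
  obtain ⟨M, hM, h⟩ := exists_mul_le_add_rpow hr hp one_pos
  have h1 : Integrable (fun x => u x ^ 2) ν := (integrable_sq (μ := μ) hu hc).mono_measure hν
  have h2 : Integrable (fun x => (u x ^ 2) ^ r) ν :=
    (integrable_sq_rpow (μ := μ) hu hc (by linarith)).mono_measure hν
  refine ((h1.const_mul M).add ((h2.add hVp).const_mul 1)).mono'
    ((aestronglyMeasurable_of_rpow hV hp0 hVp.aestronglyMeasurable).mul
      h1.aestronglyMeasurable) (ae_of_all _ fun x => ?_)
  rw [Real.norm_of_nonneg (mul_nonneg (hV x) (sq_nonneg _))]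
  exact h _ _ (hV x) (sq_nonneg _)

/-- Under a uniform superquadratic bound, local `L²` convergence to zero implies convergence to
zero in the weighted space. -/
theorem tendsto_setIntegral_mul_sq {E : Type*} [TopologicalSpace E] [MeasurableSpace E]
    [BorelSpace E] {μ : Measure E} [IsFiniteMeasureOnCompacts μ]
    {ι : Type*} {l : Filter ι} {V : E → ℝ} (hV : ∀ x, 0 ≤ V x)
    {r p : ℝ} (hr : 1 < r) (hp : 1 < (p - 1) * (r - 1)) {K : Set E}
    (hVp : IntegrableOn (fun x => V x ^ p) K μ) {w : ι → E → ℝ}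
    (hw : ∀ i, Continuous (w i)) (hc : ∀ i, HasCompactSupport (w i)) {S : ℝ}
    (hS : ∀ i, ∫ x, (w i x ^ 2) ^ r ∂μ ≤ S)
    (hlim : Tendsto (fun i => ∫ x in K, w i x ^ 2 ∂μ) l (𝓝 0)) :
    Tendsto (fun i => ∫ x in K, V x * w i x ^ 2 ∂μ) l (𝓝 0) := by
  set P := ∫ x in K, V x ^ p ∂μ with hP
  have hP0 : 0 ≤ P := integral_nonneg fun x => Real.rpow_nonneg (hV x) _
  have hS0 : 0 ≤ max S 0 := le_max_right _ _
  rw [Metric.tendsto_nhds]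
  intro δ hδ
  set η := δ / (2 * (max S 0 + P + 1)) with hη
  have hη0 : 0 < η := by positivity
  obtain ⟨M, hM, h⟩ := exists_mul_le_add_rpow hr hp hη0
  have h3 : η * (max S 0 + P) < δ / 2 := by
    rw [hη, div_mul_eq_mul_div, div_lt_div_iff₀ (by positivity) (by norm_num)]
    nlinarith
  have hM2 : Tendsto (fun i => M * ∫ x in K, w i x ^ 2 ∂μ) l (𝓝 0) := by
    simpa using hlim.const_mul M
  filter_upwards [hM2.eventually (gt_mem_nhds (half_pos hδ))] with i hi
  rw [Real.dist_eq, sub_zero,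
    abs_of_nonneg (integral_nonneg fun x => mul_nonneg (hV x) (sq_nonneg _))]
  have h1 : Integrable (fun x => w i x ^ 2) (μ.restrict K) :=
    (integrable_sq (μ := μ) (hw i) (hc i)).integrableOn
  have h2 := integrable_sq_rpow (μ := μ) (hw i) (hc i) (show 0 < r by linarith)
  have h2K : Integrable (fun x => (w i x ^ 2) ^ r) (μ.restrict K) := h2.integrableOn
  have h23 : Integrable (fun x => (w i x ^ 2) ^ r + V x ^ p) (μ.restrict K) := h2K.add hVp
  have h4 : ∫ x in K, V x * w i x ^ 2 ∂μ ≤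
      M * (∫ x in K, w i x ^ 2 ∂μ) + η * ((∫ x in K, (w i x ^ 2) ^ r ∂μ) + P) := by
    rw [hP, ← integral_add h2K hVp, ← integral_const_mul, ← integral_const_mul,
      ← integral_add (h1.const_mul M) (h23.const_mul η)]
    exact integral_mono (integrable_mul_sq_of_rpow Measure.restrict_le_self hV hr hp hVp (hw i)
      (hc i)) ((h1.const_mul M).add (h23.const_mul η)) fun x => h _ _ (hV x) (sq_nonneg _)
  have h5 : ∫ x in K, (w i x ^ 2) ^ r ∂μ ≤ max S 0 :=
    ((setIntegral_le_integral h2 (ae_of_all _ fun x => by positivity)).trans (hS i)).trans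
      (le_max_left _ _)
  have h6 : η * ((∫ x in K, (w i x ^ 2) ^ r ∂μ) + P) ≤ η * (max S 0 + P) := by gcongr
  linarith

/-- The Sobolev inequality as a bound for the critical integral on energy balls. -/
theorem exists_integral_sq_rpow_le {E : Type*} [NormedAddCommGroup E] [NormedSpace ℝ E]
    [FiniteDimensional ℝ E] [MeasurableSpace E] [BorelSpace E] (μ : Measure E)
    [μ.IsAddHaarMeasure] {n : ℕ} (hn : Module.finrank ℝ E = n) (h3 : 3 ≤ n) (G : ℝ) :
    ∃ S : ℝ, ∀ u : E → ℝ, ContDiff ℝ 1 u → HasCompactSupport u →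
      ∫ x, ‖fderiv ℝ u x‖ ^ 2 ∂μ ≤ G → ∫ x, (u x ^ 2) ^ ((n : ℝ) / (n - 2)) ∂μ ≤ S := by
  have h3' : (3 : ℝ) ≤ n := by exact_mod_cast h3
  have hn2 : (0 : ℝ) < n - 2 := by linarith
  set a : ℝ := 2 * (n / (n - 2)) with ha
  have ha0 : 0 < a := by positivity
  set q : NNReal := ⟨a, ha0.le⟩
  have hq' : (q : ℝ) = a := rfl
  have hinv : (q : ℝ)⁻¹ = (2 : NNReal)⁻¹ - (Module.finrank ℝ E : ℝ)⁻¹ := by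
    rw [hn, hq', ha]
    push_cast
    field_simp
  set C : NNReal := eLpNormLESNormFDerivOfEqInnerConst μ (2 : NNReal)
  refine ⟨(C * √G) ^ a, fun u hu hc hG => ?_⟩
  have hsob := eLpNorm_le_eLpNorm_fderiv_of_eq_inner μ hu hc (p := 2) (p' := q)
    (by norm_num) (by omega) hinv
  have hdc := hu.continuous_fderiv one_ne_zero
  have m1 : MemLp u q μ := hu.continuous.memLp_of_hasCompactSupport hc
  have m2 : MemLp (fderiv ℝ u) (2 : NNReal) μ := hdc.memLp_of_hasCompactSupport (hc.fderiv ℝ)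
  rw [m1.eLpNorm_eq_integral_rpow_norm (ENNReal.coe_ne_zero.2 fun h => ha0.ne' (by rw [← hq', h, NNReal.coe_zero]))
      ENNReal.coe_ne_top,
    m2.eLpNorm_eq_integral_rpow_norm (by simp) ENNReal.coe_ne_top] at hsob
  simp only [ENNReal.coe_toReal, hq'] at hsob
  rw [← ENNReal.ofReal_coe_nnreal, ← ENNReal.ofReal_mul (by positivity),
    ENNReal.ofReal_le_ofReal_iff (by positivity)] at hsob
  have e1 : ∫ x, (u x ^ 2) ^ ((n : ℝ) / (n - 2)) ∂μ = ∫ x, ‖u x‖ ^ a ∂μ := by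
    congr 1 with x
    rw [ha, Real.rpow_mul (norm_nonneg _)]
    simp
  have e2 : (∫ x, ‖fderiv ℝ u x‖ ^ ((2 : NNReal) : ℝ) ∂μ) ^ (((2 : NNReal) : ℝ)⁻¹) ≤ √G := by
    rw [Real.sqrt_eq_rpow]
    simp only [NNReal.coe_ofNat, Real.rpow_ofNat, one_div]
    exact Real.rpow_le_rpow (integral_nonneg fun x => by positivity) hG (by norm_num)
  have h0 : 0 ≤ ∫ x, ‖u x‖ ^ a ∂μ := integral_nonneg fun x => by positivity
  have e3 : (∫ x, ‖u x‖ ^ a ∂μ) ^ a⁻¹ ≤ C * √G :=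
    hsob.trans (mul_le_mul_of_nonneg_left e2 (NNReal.coe_nonneg _))
  rw [e1]
  calc ∫ x, ‖u x‖ ^ a ∂μ = ((∫ x, ‖u x‖ ^ a ∂μ) ^ a⁻¹) ^ a := by
        rw [← Real.rpow_mul h0, inv_mul_cancel₀ ha0.ne', Real.rpow_one]
    _ ≤ _ := Real.rpow_le_rpow (by positivity) e3 ha0.le

section TestFunctions

variable {N : ℕ} {V : EuclideanSpace ℝ (Fin N) → ℝ} {O : Set (EuclideanSpace ℝ (Fin N))}
  {u v : EuclideanSpace ℝ (Fin N) → ℝ}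

theorem IsTest.contDiff_one (hu : IsTest N O u) : ContDiff ℝ 1 u :=
  hu.1.of_le (by exact_mod_cast le_top)

theorem IsTest.add (hu : IsTest N O u) (hv : IsTest N O v) :
    IsTest N O (fun x => u x + v x) := by
  refine ⟨hu.1.add hv.1, hu.2.1.add hv.2.1, ?_⟩
  have h : tsupport (fun x => u x + v x) ⊆ tsupport u ∪ tsupport v := by
    rw [tsupport, tsupport, tsupport, ← closure_union]
    exact closure_mono (Function.support_add u v)
  exact h.trans (Set.union_subset hu.2.2 hv.2.2)

theorem IsTest.sub (hu : IsTest N O u) (hv : IsTest N O v) :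
    IsTest N O (fun x => u x - v x) := by
  refine ⟨hu.1.sub hv.1, hu.2.1.sub hv.2.1, ?_⟩
  have h : tsupport (fun x => u x - v x) ⊆ tsupport u ∪ tsupport v := by
    rw [tsupport, tsupport, tsupport, ← closure_union]
    exact closure_mono (Function.support_sub u v)
  exact h.trans (Set.union_subset hu.2.2 hv.2.2)

theorem grad2_nonneg (u : EuclideanSpace ℝ (Fin N) → ℝ) : 0 ≤ grad2 N u :=
  integral_nonneg fun _ => by positivity

theorem ven_nonneg (hV : ∀ x, 0 ≤ V x) (u : EuclideanSpace ℝ (Fin N) → ℝ) : 0 ≤ ven N V u :=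
  integral_nonneg fun x => mul_nonneg (hV x) (sq_nonneg _)

theorem mu_nonneg (hV : ∀ x, 0 ≤ V x) (O : Set (EuclideanSpace ℝ (Fin N))) : 0 ≤ mu N V O := by
  refine Real.sInf_nonneg ?_
  rintro q ⟨u, -, -, rfl⟩
  exact div_nonneg (grad2_nonneg u) (ven_nonneg hV u)

theorem mu_mul_ven_le_grad2 (hV : ∀ x, 0 ≤ V x) (hu : IsTest N O u) :
    mu N V O * ven N V u ≤ grad2 N u := by
  rcases (ven_nonneg hV u).eq_or_lt with h | h
  · rw [← h, mul_zero]
    exact grad2_nonneg u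
  · rw [← le_div_iff₀ h]
    refine csInf_le ⟨0, ?_⟩ ⟨u, hu, h, rfl⟩
    rintro q ⟨u, -, -, rfl⟩
    exact div_nonneg (grad2_nonneg u) (ven_nonneg hV u)

theorem grad2_add_add_grad2_sub (hu : ContDiff ℝ 1 u) (hv : ContDiff ℝ 1 v)
    (hcu : HasCompactSupport u) (hcv : HasCompactSupport v) :
    grad2 N (fun x => u x + v x) + grad2 N (fun x => u x - v x) =
      2 * grad2 N u + 2 * grad2 N v := by
  have i1 := integrable_norm_fderiv_sq (μ := volume) (hu.add hv) (hcu.add hcv)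
  have i2 := integrable_norm_fderiv_sq (μ := volume) (hu.sub hv) (hcu.sub hcv)
  have i3 := integrable_norm_fderiv_sq (μ := volume) hu hcu
  have i4 := integrable_norm_fderiv_sq (μ := volume) hv hcv
  unfold grad2
  rw [← integral_const_mul, ← integral_const_mul, ← integral_add (i3.const_mul 2) (i4.const_mul 2)]
  refine (integral_add i1 i2).symm.trans (integral_congr_ae (ae_of_all _ fun x => ?_))
  have hs : fderiv ℝ (fun y => u y + v y) x = fderiv ℝ u x + fderiv ℝ v x :=
    fderiv_fun_add (hu.differentiable one_ne_zero x) (hv.differentiable one_ne_zero x)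
  have key : ∀ L T : StrongDual ℝ (EuclideanSpace ℝ (Fin N)),
      ‖L + T‖ ^ 2 + ‖L - T‖ ^ 2 = 2 * ‖L‖ ^ 2 + 2 * ‖T‖ ^ 2 := by
    intro L T
    have e : ∀ A : StrongDual ℝ (EuclideanSpace ℝ (Fin N)),
        ‖(InnerProductSpace.toDual ℝ (EuclideanSpace ℝ (Fin N))).symm A‖ = ‖A‖ :=
      fun A => LinearIsometryEquiv.norm_map _ A
    have := parallelogram_law_with_norm ℝ
      ((InnerProductSpace.toDual ℝ (EuclideanSpace ℝ (Fin N))).symm L)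
      ((InnerProductSpace.toDual ℝ (EuclideanSpace ℝ (Fin N))).symm T)
    rw [← map_add, ← map_sub, e, e, e, e] at this
    linarith
  simp only
  rw [hs, fderiv_fun_sub_apply hu hv]
  exact key _ _

theorem ven_add_add_ven_sub (hu : Integrable (fun x => V x * u x ^ 2))
    (hv : Integrable (fun x => V x * v x ^ 2))
    (ha : Integrable (fun x => V x * (u x + v x) ^ 2))
    (hs : Integrable (fun x => V x * (u x - v x) ^ 2)) :
    ven N V (fun x => u x + v x) + ven N V (fun x => u x - v x) =
      2 * ven N V u + 2 * ven N V v := by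
  unfold ven
  rw [← integral_add ha hs, ← integral_const_mul, ← integral_const_mul,
    ← integral_add (hu.const_mul 2) (hv.const_mul 2)]
  congr 1 with x
  ring

/-- Energy of a product with a cutoff whose gradient is supported in `K`. -/
theorem grad2_mul_le {ψ : EuclideanSpace ℝ (Fin N) → ℝ} {K : Set (EuclideanSpace ℝ (Fin N))}
    (hK : MeasurableSet K) (hψ : ContDiff ℝ 1 ψ) (hψ1 : ∀ x, |ψ x| ≤ 1) {C : ℝ}
    (hC : ∀ x, ‖fderiv ℝ ψ x‖ ≤ C) (hψK : ∀ x ∉ K, fderiv ℝ ψ x = 0)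
    (hu : ContDiff ℝ 1 u) (hcu : HasCompactSupport u) {δ : ℝ} (hδ : 0 < δ) :
    grad2 N (fun x => ψ x * u x) ≤
      (1 + δ) * grad2 N u + (1 + δ⁻¹) * C ^ 2 * ∫ x in K, u x ^ 2 := by
  have i1 := integrable_norm_fderiv_sq (μ := volume) (hψ.mul hu) (hcu.mul_left)
  have i2 := integrable_norm_fderiv_sq (μ := volume) hu hcu
  have i3 := (integrable_sq (μ := volume) hu.continuous hcu).indicator hK
  unfold grad2
  rw [← integral_indicator hK, ← integral_const_mul, ← integral_const_mul,
    ← integral_add (i2.const_mul _) (i3.const_mul _)]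
  refine integral_mono i1 ((i2.const_mul _).add (i3.const_mul _)) fun x => ?_
  have hd : fderiv ℝ (fun y => ψ y * u y) x = ψ x • fderiv ℝ u x + u x • fderiv ℝ ψ x :=
    fderiv_fun_mul (hψ.differentiable one_ne_zero x) (hu.differentiable one_ne_zero x)
  have hn : ‖ψ x • fderiv ℝ u x‖ ≤ ‖fderiv ℝ u x‖ := by
    rw [norm_smul, Real.norm_eq_abs]
    exact mul_le_of_le_one_left (norm_nonneg _) (hψ1 x)
  simp only
  rw [hd]
  by_cases hx : x ∈ K
  · rw [Set.indicator_of_mem hx]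
    have hm : ‖u x • fderiv ℝ ψ x‖ ≤ |u x| * C := by
      rw [norm_smul, Real.norm_eq_abs]
      gcongr
      exact hC x
    have h1 := (norm_add_le (ψ x • fderiv ℝ u x) (u x • fderiv ℝ ψ x)).trans (add_le_add hn hm)
    have h2 := pow_le_pow_left₀ (norm_nonneg _) h1 2
    refine h2.trans ?_
    have h3 : (‖fderiv ℝ u x‖ + |u x| * C) ^ 2 + (δ * ‖fderiv ℝ u x‖ - |u x| * C) ^ 2 * δ⁻¹ =
        (1 + δ) * ‖fderiv ℝ u x‖ ^ 2 + (1 + δ⁻¹) * C ^ 2 * |u x| ^ 2 := by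
      field_simp
      ring
    rw [sq_abs] at h3
    rw [← h3]
    have : 0 ≤ (δ * ‖fderiv ℝ u x‖ - |u x| * C) ^ 2 * δ⁻¹ := by positivity
    linarith
  · rw [Set.indicator_of_notMem hx, hψK x hx, smul_zero, add_zero, mul_zero, add_zero]
    have h2 := pow_le_pow_left₀ (norm_nonneg _) hn 2
    nlinarith [sq_nonneg ‖fderiv ℝ u x‖]

theorem LocLp.integrable_mul_sq {X : Set (EuclideanSpace ℝ (Fin N))} {p r : ℝ}
    (hV : ∀ x, 0 ≤ V x) (hloc : LocLp N p V X) (hr : 1 < r) (hp : 1 < (p - 1) * (r - 1))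
    (hOX : O ⊆ X) (hu : IsTest N O u) : Integrable (fun x => V x * u x ^ 2) := by
  have h := integrable_mul_sq_of_rpow Measure.restrict_le_self hV hr hp
    (hloc (tsupport u) hu.2.1 (hu.2.2.trans hOX)) hu.1.continuous hu.2.1
  refine (integrableOn_iff_integrable_of_support_subset (s := tsupport u) fun x hx => ?_).1 h
  refine subset_tsupport u ?_
  contrapose! hx
  simp only [Function.mem_support, not_not] at hx ⊢
  simp [hx]

/-- A smooth cutoff equal to zero near a compact set and to one outside a compact neighbourhood. -/
theorem exists_cutoff {B X : Set (EuclideanSpace ℝ (Fin N))} (hB : IsCompact (closure B))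
    (hX : IsOpen X) (hBX : closure B ⊆ X) :
    ∃ (ψ : EuclideanSpace ℝ (Fin N) → ℝ) (K : Set (EuclideanSpace ℝ (Fin N))) (C : ℝ),
      IsCompact K ∧ K ⊆ X ∧ ContDiff ℝ (⊤ : ℕ∞) ψ ∧ (∀ x, |ψ x| ≤ 1) ∧
      (∀ x, ‖fderiv ℝ ψ x‖ ≤ C) ∧ (∀ x ∉ K, fderiv ℝ ψ x = 0) ∧ (∀ x ∉ K, ψ x = 1) ∧
      Disjoint (tsupport ψ) (closure B) := by
  obtain ⟨K, hK, hBK, hKX⟩ := exists_compact_between hB hX hBX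
  obtain ⟨f, hf1, hf0, hf⟩ := exists_contMDiffMap_one_nhds_of_subset_interior
    (n := (⊤ : ℕ∞)) (modelWithCornersSelf ℝ (EuclideanSpace ℝ (Fin N)))
    isClosed_closure hBK
  have hfs : ContDiff ℝ (⊤ : ℕ∞) f := f.contMDiff.contDiff
  have hψ : ContDiff ℝ (⊤ : ℕ∞) fun x => 1 - f x := contDiff_const.sub hfs
  have hz : ∀ x ∉ K, fderiv ℝ (fun x => 1 - f x) x = 0 := by
    intro x hx
    have : (fun x => 1 - f x) =ᶠ[𝓝 x] fun _ => (1 : ℝ) := by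
      filter_upwards [hK.isClosed.isOpen_compl.mem_nhds hx] with y hy
      rw [hf0 y hy, sub_zero]
    rw [this.fderiv_eq]
    simp
  have hdc : Continuous (fderiv ℝ fun x => 1 - f x) := hψ.continuous_fderiv (by simp)
  obtain ⟨C, hC⟩ := (HasCompactSupport.intro hK hz).exists_bound_of_continuous hdc
  refine ⟨fun x => 1 - f x, K, C, hK, hKX, hψ, fun x => ?_, hC, hz, fun x hx => ?_, ?_⟩
  · have := hf x
    rw [abs_le]
    constructor <;> linarith [this.1, this.2]
  · simp [hf0 x hx]
  · rw [Set.disjoint_left]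
    intro x hx hxB
    obtain ⟨U, hU, hBU, hfU⟩ := eventually_nhdsSet_iff_exists.1 hf1
    refine notMem_tsupport_iff_eventuallyEq.2 ?_ hx
    filter_upwards [hU.mem_nhds (hBU hxB)] with y hy
    simp [hfU y hy]

end TestFunctions

/-- **Lemma 2.2 (Pinchover–Tintarev).** If `B ⋐ X` is open and `μ_{Ω∪B} < μ_Ω`, then
`μ_{Ω∪B}` is attained: every normalized minimizing sequence has a subsequence whose
gradients are Cauchy in `L²(ℝᴺ; ℝᴺ)`. -/
theorem minimizing_sequence_converges_of_strict_gap
    (N : ℕ) (hN : 3 ≤ N) (p : ℝ) (hp : (N : ℝ) / 2 < p)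
    (X : Set (EuclideanSpace ℝ (Fin N))) (hXop : IsOpen X) (hXconn : IsConnected X)
    (V : EuclideanSpace ℝ (Fin N) → ℝ) (hV0 : ∀ x, 0 ≤ V x) (hVloc : LocLp N p V X)
    (hmuX : 0 < mu N V X)
    (Ω : Set (EuclideanSpace ℝ (Fin N))) (hΩop : IsOpen Ω) (hΩconn : IsConnected Ω)
    (hΩX : Ω ⊆ X)
    (hne : ∃ u₀, IsTest N Ω u₀ ∧ 0 < ven N V u₀)
    (B : Set (EuclideanSpace ℝ (Fin N))) (hBop : IsOpen B)
    (hBcp : IsCompact (closure B)) (hBX : closure B ⊆ X)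
    (hgap : mu N V (Ω ∪ B) < mu N V Ω) :
    ∀ u : ℕ → EuclideanSpace ℝ (Fin N) → ℝ, MinimizingSeq N V (Ω ∪ B) u →
      ∃ k : ℕ → ℕ, StrictMono k ∧ GradCauchy N (u ∘ k) := by
  intro u ⟨hut, huv, hulim⟩
  have hN3 : (3 : ℝ) ≤ N := by exact_mod_cast hN
  have hN2 : (0 : ℝ) < N - 2 := by linarith
  set r : ℝ := (N : ℝ) / (N - 2) with hr
  have hr1 : 1 < r := by
    rw [hr, lt_div_iff₀ hN2]
    linarith
  have hpr : 1 < (p - 1) * (r - 1) := by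
    have : r - 1 = 2 / (N - 2) := by
      rw [hr]
      field_simp
      ring
    rw [this, mul_div_assoc', lt_div_iff₀ hN2]
    linarith
  have hOX : Ω ∪ B ⊆ X := Set.union_subset hΩX (subset_closure.trans hBX)
  obtain ⟨ψ, K, C, hK, hKX, hψ, hψ1, hψC, hψd, hψK, hψB⟩ := exists_cutoff hBcp hXop hBX
  have hψ' : ContDiff ℝ 1 ψ := hψ.of_le (by exact_mod_cast le_top)
  obtain ⟨R, hKR⟩ := hK.isBounded.subset_closedBall 0
  obtain ⟨G, hG⟩ := hulim.bddAbove_range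
  have hG : ∀ n, grad2 N (u n) ≤ G := fun n => hG ⟨n, rfl⟩
  obtain ⟨S, hS⟩ := exists_integral_sq_rpow_le
    (volume : Measure (EuclideanSpace ℝ (Fin N))) finrank_euclideanSpace_fin hN (4 * G)
  have hu1 : ∀ n, ContDiff ℝ 1 (u n) := fun n => (hut n).contDiff_one
  have huc : ∀ n, HasCompactSupport (u n) := fun n => (hut n).2.1
  have hG0 : 0 ≤ G := (grad2_nonneg _).trans (hG 0)
  have hM : ∀ n, ∫ x in Metric.closedBall 0 (R + 1), u n x ^ 2 ≤
      (volume (Metric.closedBall (0 : EuclideanSpace ℝ (Fin N)) (R + 1))).toReal + S := by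
    intro n
    have i1 : IntegrableOn (fun _ : EuclideanSpace ℝ (Fin N) => (1 : ℝ))
        (Metric.closedBall 0 (R + 1)) := integrableOn_const measure_closedBall_lt_top.ne
    have i2 := integrable_sq_rpow (μ := volume) (hu1 n).continuous (huc n)
      (show 0 < r by linarith)
    calc ∫ x in Metric.closedBall 0 (R + 1), u n x ^ 2
        ≤ ∫ x in Metric.closedBall 0 (R + 1), (1 + (u n x ^ 2) ^ r) := by
          refine integral_mono (integrable_sq (hu1 n).continuous (huc n)).integrableOn
            (i1.add i2.integrableOn) fun x => ?_
          have h0 : 0 ≤ u n x ^ 2 := sq_nonneg _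
          rcases le_total (u n x ^ 2) 1 with h | h
          · have : 0 ≤ (u n x ^ 2) ^ r := by positivity
            simp only
            linarith
          · have := Real.self_le_rpow_of_one_le h hr1.le
            simp only
            linarith
      _ = (volume (Metric.closedBall (0 : EuclideanSpace ℝ (Fin N)) (R + 1))).toReal +
          ∫ x in Metric.closedBall 0 (R + 1), (u n x ^ 2) ^ r := by
          rw [integral_add i1 i2.integrableOn]
          simp [Measure.real]
      _ ≤ _ := by
          gcongr
          exact (setIntegral_le_integral i2 (ae_of_all _ fun x => by positivity)).trans
            (hS _ (hu1 n) (huc n) ((hG n).trans (by linarith)))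
  obtain ⟨k, hk, hlim⟩ := exists_subseq_tendsto_setIntegral_sq_sub hu1 huc hG hM
  refine ⟨k, hk, ?_⟩
  let w : ℕ × ℕ → EuclideanSpace ℝ (Fin N) → ℝ := fun q x => u (k q.1) x - u (k q.2) x
  have hwt : ∀ q, IsTest N (Ω ∪ B) (w q) := fun q => (hut _).sub (hut _)
  have hpar : ∀ q : ℕ × ℕ, grad2 N (fun x => u (k q.1) x + u (k q.2) x) + grad2 N (w q) =
      2 * grad2 N (u (k q.1)) + 2 * grad2 N (u (k q.2)) :=
    fun q => grad2_add_add_grad2_sub (hu1 _) (hu1 _) (huc _) (huc _)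
  have hint : ∀ {f}, IsTest N (Ω ∪ B) f → Integrable (fun x => V x * f x ^ 2) :=
    fun hf => hVloc.integrable_mul_sq hV0 hr1 hpr hOX hf
  have hparV : ∀ q : ℕ × ℕ, ven N V (fun x => u (k q.1) x + u (k q.2) x) + ven N V (w q) = 4 := by
    intro q
    rw [ven_add_add_ven_sub (hint (hut _)) (hint (hut _)) (hint ((hut _).add (hut _)))
      (hint ((hut _).sub (hut _))), huv, huv]
    norm_num
  have hwG : ∀ q, grad2 N (w q) ≤ 4 * G := fun q => by
    linarith [hpar q, grad2_nonneg (fun x => u (k q.1) x + u (k q.2) x), hG (k q.1), hG (k q.2)]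
  have hb : Tendsto (fun q => ∫ x in K, w q x ^ 2) atTop (𝓝 0) :=
    squeeze_zero (fun q => integral_nonneg fun x => sq_nonneg _)
      (fun q => setIntegral_mono_set
        (integrable_sq (hwt q).1.continuous (hwt q).2.1).integrableOn
        (ae_of_all _ fun x => sq_nonneg _) hKR.eventuallyLE) hlim
  have ha : Tendsto (fun q => ∫ x in K, V x * w q x ^ 2) atTop (𝓝 0) :=
    tendsto_setIntegral_mul_sq hV0 hr1 hpr (hVloc K hK hKX) (fun q => (hwt q).1.continuous)
      (fun q => (hwt q).2.1) (fun q => hS _ (hwt q).contDiff_one (hwt q).2.1 (hwG q)) hb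
  set m₀ := mu N V (Ω ∪ B) with hm₀
  set m₁ := mu N V Ω with hm₁
  have hm₀0 : 0 ≤ m₀ := mu_nonneg hV0 _
  have hm₁0 : 0 < m₁ := hm₀0.trans_lt hgap
  set δ : ℝ := (m₁ - m₀) / (2 * m₁) with hδ
  have hδ0 : 0 < δ := div_pos (by linarith) (by linarith)
  have hδm : m₁ * δ = (m₁ - m₀) / 2 := by
    rw [hδ]
    field_simp
  set D : ℝ := (1 + δ⁻¹) * C ^ 2
  let e : ℕ × ℕ → ℝ := fun q => 2 * grad2 N (u (k q.1)) + 2 * grad2 N (u (k q.2)) - 4 * m₀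
  have he : Tendsto e atTop (𝓝 0) := by
    have h0 := hulim.comp hk.tendsto_atTop
    have h1 := h0.comp (tendsto_fst (f := (atTop : Filter ℕ)) (g := (atTop : Filter ℕ)))
    have h2 := h0.comp (tendsto_snd (f := (atTop : Filter ℕ)) (g := (atTop : Filter ℕ)))
    rw [prod_atTop_atTop_eq] at h1 h2
    have := ((h1.const_mul 2).add (h2.const_mul 2)).sub_const (4 * m₀)
    rwa [show 2 * m₀ + 2 * m₀ - 4 * m₀ = 0 by ring] at this
  have hupper : ∀ q, grad2 N (w q) ≤ m₀ * ven N V (w q) + e q := by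
    intro q
    have h1 := mu_mul_ven_le_grad2 hV0 ((hut (k q.1)).add (hut (k q.2)))
    have h2 : ven N V (fun x => u (k q.1) x + u (k q.2) x) = 4 - ven N V (w q) := by
      linarith [hparV q]
    rw [h2, ← hm₀] at h1
    simp only [e]
    linarith [hpar q]
  have hψt : ∀ q, IsTest N Ω (fun x => ψ x * w q x) := by
    intro q
    refine ⟨hψ.mul (hwt q).1, (hwt q).2.1.mul_left, fun x hx => ?_⟩
    have hx1 : x ∈ tsupport ψ := tsupport_mul_subset_left hx
    have hx2 : x ∈ tsupport (w q) := tsupport_mul_subset_right hx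
    rcases (hwt q).2.2 hx2 with h | h
    · exact h
    · exact absurd (subset_closure h) (Set.disjoint_left.1 hψB hx1)
  have hvenψ : ∀ q, ven N V (w q) - (∫ x in K, V x * w q x ^ 2) ≤
      ven N V (fun x => ψ x * w q x) := by
    intro q
    have i1 := hint (hwt q)
    have i2 := i1.indicator hK.measurableSet
    unfold ven
    rw [← integral_indicator hK.measurableSet, ← integral_sub i1 i2]
    refine integral_mono (i1.sub i2)
      (hVloc.integrable_mul_sq hV0 hr1 hpr hΩX (hψt q)) fun x => ?_
    by_cases hx : x ∈ K
    · simp only [Set.indicator_of_mem hx, sub_self]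
      exact mul_nonneg (hV0 x) (sq_nonneg _)
    · simp [Set.indicator_of_notMem hx, hψK x hx]
  have hfinal : ∀ q, grad2 N (w q) ≤ 2 / (m₁ - m₀) *
      (m₀ * (m₁ * (∫ x in K, V x * w q x ^ 2) + D * ∫ x in K, w q x ^ 2) + m₁ * e q) := by
    intro q
    have h1 := mu_mul_ven_le_grad2 hV0 (hψt q)
    have h2 := grad2_mul_le hK.measurableSet hψ' hψ1 hψC hψd (hwt q).contDiff_one (hwt q).2.1 hδ0
    have h3 := mul_le_mul_of_nonneg_left (hvenψ q) hm₁0.le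
    rw [← hm₁] at h1
    have h4 := mul_le_mul_of_nonneg_left ((h3.trans h1).trans h2) hm₀0
    have h5 := mul_le_mul_of_nonneg_left (hupper q) hm₁0.le
    have h6 : m₀ * δ * grad2 N (w q) ≤ (m₁ - m₀) / 2 * grad2 N (w q) := by
      rw [← hδm]
      have := grad2_nonneg (w q)
      gcongr
    rw [div_mul_eq_mul_div, le_div_iff₀ (by linarith)]
    linarith
  have hlimW : Tendsto (fun q => grad2 N (w q)) atTop (𝓝 0) := by
    refine squeeze_zero (fun q => grad2_nonneg _) hfinal ?_
    have := ((((ha.const_mul m₁).add (hb.const_mul D)).const_mul m₀).add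
      (he.const_mul m₁)).const_mul (2 / (m₁ - m₀))
    simpa using this
  intro ε hε
  obtain ⟨⟨a, b⟩, hab⟩ := eventually_atTop.1 (hlimW.eventually (gt_mem_nhds hε))
  refine ⟨max a b, fun j hj l hl => ?_⟩
  have h := hab (j, l) ⟨(le_max_left _ _).trans hj, (le_max_right _ _).trans hl⟩
  simp only [grad2, w, fderiv_fun_sub_apply (hu1 _) (hu1 _)] at h
  exact h
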